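/- Let m ≥ 1, let a > 0, and let C : ℝ^m → ℝ be continuous. Then for every w ∈ ℝ^m and every coordinate index i ∈ {1,…,m}, the partial derivative of the smoothed function C̄ in the i-th coordinate direction at w exists and equals (2a)^{−m} ∫_{D(w_{\i}, a)} ( C(w')|_{w'_i = w_i + a} − C(w')|_{w'_i = w_i − a} ) dw'_{\i}, where the integral is over the (m−1)-dimensional closed ℓ∞-box of radius a centered at the vector w_{\i} of the remaining coordinates of w, and C(w')|_{w'_i = c} denotes C evaluated with the i-th coordinate fixed to c and the remaining coordinates ranging over that box. -/

import Mathlib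

open MeasureTheory

noncomputable section

/-- The closed ℓ∞-box `D(w, ς)` of radius `ς` centered at `w`. -/
def box {m : ℕ} (w : Fin m → ℝ) (ς : ℝ) : Set (Fin m → ℝ) :=
  {w' | ∀ i, |w' i - w i| ≤ ς}

/-- The smoothed function `C̄(w) = (2a)^{-m} ∫_{D(w,a)} C(w') dw'`. -/
def smoothed {m : ℕ} (a : ℝ) (C : (Fin m → ℝ) → ℝ) (w : Fin m → ℝ) : ℝ :=
  ((2 * a) ^ m)⁻¹ * ∫ w' in box w a, C w'

/-- The point of `ℝ^m` whose `i`-th coordinate is `c` and whose remaining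
coordinates are given by `u`. -/
def insertAt {m : ℕ} (i : Fin m) (c : ℝ) (u : {j : Fin m // j ≠ i} → ℝ) :
    Fin m → ℝ :=
  fun j => if h : j = i then c else u ⟨j, h⟩

/-- The `(m-1)`-dimensional closed ℓ∞-box of radius `ς` centered at the vector of
the coordinates of `w` other than the `i`-th one. -/
def subBox {m : ℕ} (i : Fin m) (w : Fin m → ℝ) (ς : ℝ) :
    Set ({j : Fin m // j ≠ i} → ℝ) :=
  {u | ∀ j : {j : Fin m // j ≠ i}, |u j - w j.1| ≤ ς}

theorem insertAt_mp {m : ℕ} (i : Fin m) :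
    ∃ e : ℝ × ({j : Fin m // j ≠ i} → ℝ) ≃ᵐ (Fin m → ℝ),
      MeasurePreserving e volume volume ∧ ∀ p, e p = insertAt i p.1 p.2 := by
  have h1 := (volume_preserving_piEquivPiSubtypeProd (fun _ : Fin m => ℝ) (fun j => j = i)).symm
  have h2 := (volume_preserving_funUnique {j : Fin m // j = i} ℝ).symm
  have h3 := h2.prod (MeasurePreserving.id (volume : Measure ({j : Fin m // j ≠ i} → ℝ)))
  refine ⟨((MeasurableEquiv.funUnique {j : Fin m // j = i} ℝ).symm.prodCongr
    (MeasurableEquiv.refl ({j : Fin m // j ≠ i} → ℝ))).trans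
    (MeasurableEquiv.piEquivPiSubtypeProd (fun _ : Fin m => ℝ) (fun j => j = i)).symm, ?_, ?_⟩
  · refine h1.comp (?_ : MeasurePreserving (Prod.map
      (⇑(MeasurableEquiv.funUnique { j // j = i } ℝ).symm) id) _ _)
    convert h3
    · rfl
    · rw [← Measure.volume_eq_prod]
    · rw [Measure.volume_eq_prod]
      congr!
  · rintro ⟨c, u⟩
    funext j
    by_cases h : j = i
    · simp [insertAt, h, MeasurableEquiv.piEquivPiSubtypeProd, MeasurableEquiv.funUnique,
        MeasurableEquiv.piUnique, Equiv.piEquivPiSubtypeProd, MeasurableEquiv.prodCongr]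
    · simp [insertAt, h, MeasurableEquiv.piEquivPiSubtypeProd, MeasurableEquiv.funUnique,
        Equiv.piEquivPiSubtypeProd, MeasurableEquiv.prodCongr]

theorem continuous_insertAt {m : ℕ} (i : Fin m) :
    Continuous (fun p : ℝ × ({j : Fin m // j ≠ i} → ℝ) => insertAt i p.1 p.2) := by
  refine continuous_pi fun j => ?_
  by_cases h : j = i
  · simpa [insertAt, h] using continuous_fst
  · simp only [insertAt, h, dite_false]
    fun_prop

theorem subBox_eq {m : ℕ} (i : Fin m) (w : Fin m → ℝ) (a : ℝ) :
    subBox i w a = Set.Icc (fun j => w j.1 - a) (fun j => w j.1 + a) := by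
  ext u
  simp only [subBox, Set.mem_ofPred_eq, Set.mem_Icc, Pi.le_def, abs_le, ← forall_and]
  refine forall_congr' fun j => ?_
  constructor <;> rintro ⟨h1, h2⟩ <;> constructor <;> linarith

theorem box_integral {m : ℕ} (a : ℝ) (ha : 0 < a)
    (C : (Fin m → ℝ) → ℝ) (hC : Continuous C) (w : Fin m → ℝ) (i : Fin m) (t : ℝ) :
    ∫ w' in box (Function.update w i t) a, C w' =
      ∫ c in (t - a)..(t + a), ∫ u in subBox i w a, C (insertAt i c u) := by
  obtain ⟨e, he, hE⟩ := insertAt_mp i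
  have hpre : e ⁻¹' (box (Function.update w i t) a) =
      Set.Icc (t - a) (t + a) ×ˢ subBox i w a := by
    ext ⟨c, u⟩
    simp only [Set.mem_preimage, hE, box, subBox, Set.mem_ofPred_eq, Set.mem_prod, Set.mem_Icc]
    constructor
    · intro h
      refine ⟨?_, fun j => ?_⟩
      · have := h i
        simp only [insertAt, dite_true, Function.update_self, abs_le] at this
        constructor <;> linarith [this.1, this.2]
      · simpa [insertAt, j.2] using h j.1
    · rintro ⟨⟨h1, h2⟩, h⟩ j
      by_cases hj : j = i
      · subst hj
        simp only [insertAt, dite_true, Function.update_self, abs_le]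
        constructor <;> linarith
      · simpa [insertAt, hj] using h ⟨j, hj⟩
  rw [← he.setIntegral_preimage_emb e.measurableEmbedding, hpre,
    intervalIntegral.integral_of_le (by linarith), ← integral_Icc_eq_integral_Ioc]
  simp only [hE]
  rw [Measure.volume_eq_prod, setIntegral_prod]
  refine ContinuousOn.integrableOn_compact ?_ (hC.comp (continuous_insertAt i)).continuousOn
  rw [subBox_eq]
  exact isCompact_Icc.prod isCompact_Icc

theorem hasDerivAt_smoothed_coord
    {m : ℕ} (hm : 1 ≤ m) (a : ℝ) (ha : 0 < a)
    (C : (Fin m → ℝ) → ℝ) (hC : Continuous C)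
    (w : Fin m → ℝ) (i : Fin m) :
    HasDerivAt (fun t : ℝ => smoothed a C (Function.update w i t))
      (((2 * a) ^ m)⁻¹ *
        ∫ u in subBox i w a,
          (C (insertAt i (w i + a) u) - C (insertAt i (w i - a) u)))
      (w i) := by
  have hK : IsCompact (subBox i w a) := by rw [subBox_eq]; exact isCompact_Icc
  have hCi := hC.comp (continuous_insertAt i)
  have hc : ∀ c, Continuous fun u => C (insertAt i c u) := fun c =>
    hCi.comp (Continuous.prodMk_right c)
  have hG : Continuous fun c => ∫ u in subBox i w a, C (insertAt i c u) :=
    continuous_parametric_integral_of_continuous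
      (f := fun c u => C (insertAt i c u)) hCi hK
  have hI : ∀ c, IntegrableOn (fun u => C (insertAt i c u)) (subBox i w a) := fun c =>
    (hc c).continuousOn.integrableOn_compact hK
  unfold smoothed
  simp only [box_integral a ha C hC w i]
  refine HasDerivAt.const_mul _ ?_
  rw [integral_sub (hI _) (hI _)]
  set G := fun c => ∫ u in subBox i w a, C (insertAt i c u) with hGd
  have hF : ∀ x, HasDerivAt (fun y => ∫ c in (0:ℝ)..y, G c) (G x) x := fun x =>
    hG.integral_hasStrictDerivAt 0 x |>.hasDerivAt
  have h1 := (hF (w i + a)).comp_add_const (w i) a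
  have h2 := (hF (w i - a)).comp_sub_const (w i) a
  refine (h1.sub h2).congr_of_eventuallyEq (Filter.Eventually.of_forall fun t => ?_)
  exact (intervalIntegral.integral_interval_sub_left
    (hG.intervalIntegrable _ _) (hG.intervalIntegrable _ _)).symm
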